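/- Fix integers d > r ≥ 1 and reals λ₁* ≥ ⋯ ≥ λ_d* ≥ 0, and let Σ = diag(λ₁*, …, λ_d*) and Λ_res = diag(λ_{r+1}*, …, λ_d*) ∈ ℝ^{(d−r)×(d−r)}. Let L, L' ∈ ℝ^{d×r} satisfy L' = L + η(I_d − LLᵀ)ΣL with η > 0, write L = (Vᵀ Hᵀ)ᵀ and L' = (V'ᵀ H'ᵀ)ᵀ where H, H' ∈ ℝ^{(d−r)×r} are the last d−r rows, and set X = Σ^{1/2}L. Then H' = H + η·Λ_res·H − η·H·XᵀX, and if η·σ₁(X)² ≤ 1, then σ₁(H') ≤ (1 + η·λ_{r+1}* − η·σ_r(X)²)·σ₁(H). -/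

import Mathlib

open Matrix

/-- The largest singular value of a real matrix. -/
noncomputable def sigmaMax {m n : ℕ} (M : Matrix (Fin m) (Fin n) ℝ) : ℝ :=
  sSup {c : ℝ | ∃ v : EuclideanSpace ℝ (Fin n), ‖v‖ = 1 ∧
    c = ‖(EuclideanSpace.equiv (Fin m) ℝ).symm (M.mulVec ((EuclideanSpace.equiv (Fin n) ℝ) v))‖}

/-- The smallest singular value (the `n`-th largest, for a matrix with `n` columns). -/
noncomputable def sigmaMin {m n : ℕ} (M : Matrix (Fin m) (Fin n) ℝ) : ℝ :=
  sInf {c : ℝ | ∃ v : EuclideanSpace ℝ (Fin n), ‖v‖ = 1 ∧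
    c = ‖(EuclideanSpace.equiv (Fin m) ℝ).symm (M.mulVec ((EuclideanSpace.equiv (Fin n) ℝ) v))‖}

/-- Frobenius norm of a real matrix. -/
noncomputable def frobNorm {m n : ℕ} (M : Matrix (Fin m) (Fin n) ℝ) : ℝ :=
  Real.sqrt (∑ i, ∑ j, (M i j) ^ 2)

/-- Gradient descent iterates `X_{t+1} = X_t + η (Σ - X_t X_tᵀ) X_t`. -/
noncomputable def gdIter {d r : ℕ} (S : Matrix (Fin d) (Fin d) ℝ) (η : ℝ)
    (X0 : Matrix (Fin d) (Fin r) ℝ) : ℕ → Matrix (Fin d) (Fin r) ℝ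
  | 0 => X0
  | t + 1 => gdIter S η X0 t +
      η • ((S - gdIter S η X0 t * (gdIter S η X0 t)ᵀ) * gdIter S η X0 t)

/-- The top `r × r` block `U` (first `r` rows) of `X ∈ ℝ^{d×r}`. -/
def topBlock {d r : ℕ} (h : r ≤ d) (X : Matrix (Fin d) (Fin r) ℝ) :
    Matrix (Fin r) (Fin r) ℝ :=
  fun i j => X (Fin.castLE h i) j

/-- The bottom `(d-r) × r` block `J` (last `d-r` rows) of `X ∈ ℝ^{d×r}`. -/
def botBlock {d r : ℕ} (X : Matrix (Fin d) (Fin r) ℝ) :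
    Matrix (Fin (d - r)) (Fin r) ℝ :=
  fun i j => X ⟨r + (i : ℕ), by have := i.isLt; omega⟩ j

/-- The region `R = {X : σ₁(X)² ≤ 2λ₁*, σ₁(J)² ≤ λ_r* − Δ/2, σ_r(U)² ≥ Δ/4}`. -/
def inR {d r : ℕ} (h : r ≤ d) (lam1 lamr Δ : ℝ) (X : Matrix (Fin d) (Fin r) ℝ) : Prop :=
  sigmaMax X ^ 2 ≤ 2 * lam1 ∧ sigmaMax (botBlock X) ^ 2 ≤ lamr - Δ / 2 ∧
    Δ / 4 ≤ sigmaMin (topBlock h X) ^ 2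

/-- The region `R₂ = {X : σ₁(X)² ≤ 2λ₁*, σ₁(J)² ≤ λ_r* − Δ/2}`. -/
def inR2 {d r : ℕ} (lam1 lamr Δ : ℝ) (X : Matrix (Fin d) (Fin r) ℝ) : Prop :=
  sigmaMax X ^ 2 ≤ 2 * lam1 ∧ sigmaMax (botBlock X) ^ 2 ≤ lamr - Δ / 2


section L2Norm

open scoped Matrix.Norms.L2Operator

/-- If `η‖T‖² ≤ 1` and `T` is bounded below by `s`, then `1 - η T†T` has norm at most
`1 - η s²`. -/
theorem ContinuousLinearMap.norm_one_sub_smul_adjoint_comp_self_le {E F : Type*}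
    [NormedAddCommGroup E] [InnerProductSpace ℝ E] [CompleteSpace E] [Nontrivial E]
    [NormedAddCommGroup F] [InnerProductSpace ℝ F] [CompleteSpace F]
    (T : E →L[ℝ] F) {η s : ℝ} (hη : 0 ≤ η) (hs : 0 ≤ s) (hT : η * ‖T‖ ^ 2 ≤ 1)
    (hsT : ∀ x, s * ‖x‖ ≤ ‖T x‖) :
    ‖(1 : E →L[ℝ] E) - η • (adjoint T ∘L T)‖ ≤ 1 - η * s ^ 2 := by
  have hsym : ((1 : E →L[ℝ] E) - η • (adjoint T ∘L T)).IsSymmetric := by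
    intro x y
    simp [inner_sub_left, inner_sub_right, inner_smul_left, inner_smul_right,
      adjoint_inner_left, adjoint_inner_right]
  have hform : ∀ x, ((1 : E →L[ℝ] E) - η • (adjoint T ∘L T)).reApplyInnerSelf x =
      ‖x‖ ^ 2 - η * ‖T x‖ ^ 2 := by
    intro x
    simp [reApplyInnerSelf_apply, inner_sub_left, inner_smul_left, adjoint_inner_left]
  have hs_le : s ≤ ‖T‖ := by
    obtain ⟨x, hx⟩ := exists_ne (0 : E)
    exact le_of_mul_le_mul_right ((hsT x).trans (T.le_opNorm x)) (norm_pos_iff.mpr hx)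
  have hc : 0 ≤ 1 - η * s ^ 2 := by
    have : η * s ^ 2 ≤ η * ‖T‖ ^ 2 := by gcongr
    linarith
  rw [norm_eq_iSup_rayleighQuotient _ hsym]
  refine ciSup_le fun x => ?_
  have hupper : η * ‖T x‖ ^ 2 ≤ ‖x‖ ^ 2 :=
    calc η * ‖T x‖ ^ 2 ≤ η * (‖T‖ * ‖x‖) ^ 2 := by gcongr; exact T.le_opNorm x
      _ = η * ‖T‖ ^ 2 * ‖x‖ ^ 2 := by ring
      _ ≤ ‖x‖ ^ 2 := mul_le_of_le_one_left (by positivity) hT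
  have hlower : η * (s * ‖x‖) ^ 2 ≤ η * ‖T x‖ ^ 2 := by gcongr; exact hsT x
  rw [rayleighQuotient, hform, abs_of_nonneg (div_nonneg (by linarith) (by positivity))]
  refine div_le_of_le_mul₀ (by positivity) hc ?_
  linarith [mul_pow s ‖x‖ 2, mul_assoc η (s ^ 2) (‖x‖ ^ 2)]

theorem sigmaMax_eq_l2_opNorm {m n : ℕ} (M : Matrix (Fin m) (Fin n) ℝ) :
    sigmaMax M = ‖M‖ := by
  rw [Matrix.l2_opNorm_def, ← ContinuousLinearMap.sSup_sphere_eq_norm]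
  refine congrArg sSup (Set.ext fun c => ?_)
  simp only [Set.mem_ofPred_eq, Set.mem_image, mem_sphere_zero_iff_norm]
  exact exists_congr fun v => and_congr_right fun _ => eq_comm

theorem sigmaMin_nonneg {m n : ℕ} (M : Matrix (Fin m) (Fin n) ℝ) : 0 ≤ sigmaMin M :=
  Real.sInf_nonneg fun _ ⟨_, _, hc⟩ => hc ▸ norm_nonneg _

theorem sigmaMin_mul_norm_le {m n : ℕ} (M : Matrix (Fin m) (Fin n) ℝ)
    (v : EuclideanSpace ℝ (Fin n)) : sigmaMin M * ‖v‖ ≤ ‖toEuclideanLin M v‖ := by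
  rcases eq_or_ne v 0 with rfl | hv
  · simp
  have hv' : 0 < ‖v‖ := norm_pos_iff.mpr hv
  rw [← le_div_iff₀ hv']
  refine csInf_le ⟨0, fun _ ⟨_, _, hc⟩ => hc ▸ norm_nonneg _⟩
    ⟨‖v‖⁻¹ • v, norm_smul_inv_norm hv, ?_⟩
  change _ = ‖toEuclideanLin M (‖v‖⁻¹ • v)‖
  rw [map_smul, norm_smul, norm_inv, norm_norm, div_eq_inv_mul]

theorem norm_one_sub_smul_transpose_mul_self_le {m n : ℕ} (hn : 0 < n)
    (X : Matrix (Fin m) (Fin n) ℝ) {η : ℝ} (hη : 0 ≤ η) (hX : η * sigmaMax X ^ 2 ≤ 1) :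
    ‖1 - η • (Xᵀ * X)‖ ≤ 1 - η * sigmaMin X ^ 2 := by
  have : Nonempty (Fin n) := ⟨⟨0, hn⟩⟩
  rw [sigmaMax_eq_l2_opNorm, Matrix.l2_opNorm_def] at hX
  refine le_of_eq_of_le ?_ (ContinuousLinearMap.norm_one_sub_smul_adjoint_comp_self_le _ hη
    (sigmaMin_nonneg X) hX (sigmaMin_mul_norm_le X))
  rw [Matrix.l2_opNorm_def]
  congr 1
  rw [← conjTranspose_eq_transpose_of_trivial]
  have hadj := toEuclideanLin_conjTranspose_eq_adjoint X
  ext1 v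
  have hv := congrArg (fun f => f (toEuclideanLin X v)) hadj
  simp only [LinearEquiv.trans_apply, map_sub, map_smul, _root_.sub_apply, _root_.smul_apply]
  congr 1
  · exact congrArg (WithLp.toLp 2) (one_mulVec _)
  · congr 1
    exact .trans (congrArg (WithLp.toLp 2) (mulVec_mulVec v.ofLp Xᴴ X).symm) hv

theorem sigmaMax_add_smul_sub_smul_le {m k n : ℕ} (hn : 0 < n)
    (H : Matrix (Fin m) (Fin n) ℝ) (w : Fin m → ℝ) (X : Matrix (Fin k) (Fin n) ℝ) {η c : ℝ}
    (hη : 0 ≤ η) (hX : η * sigmaMax X ^ 2 ≤ 1) (hc : 0 ≤ c) (hw : ∀ i, |w i| ≤ c) :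
    sigmaMax (H + η • (diagonal w * H) - η • (H * (Xᵀ * X))) ≤
      (1 + η * c - η * sigmaMin X ^ 2) * sigmaMax H := by
  have hsplit : H + η • (diagonal w * H) - η • (H * (Xᵀ * X)) =
      H * (1 - η • (Xᵀ * X)) + η • (diagonal w * H) := by
    rw [Matrix.mul_sub, Matrix.mul_one, Matrix.mul_smul]
    abel
  have hdiag : ‖diagonal w‖ ≤ c := by
    rw [Matrix.l2_opNorm_diagonal, pi_norm_le_iff_of_nonneg hc]
    exact hw
  have hcontract := norm_one_sub_smul_transpose_mul_self_le hn X hη hX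
  rw [sigmaMax_eq_l2_opNorm, sigmaMax_eq_l2_opNorm, hsplit]
  calc ‖H * (1 - η • (Xᵀ * X)) + η • (diagonal w * H)‖
      ≤ ‖H * (1 - η • (Xᵀ * X))‖ + ‖η • (diagonal w * H)‖ := norm_add_le _ _
    _ ≤ ‖H‖ * ‖1 - η • (Xᵀ * X)‖ + η * (‖diagonal w‖ * ‖H‖) := by
        rw [norm_smul, Real.norm_of_nonneg hη]
        gcongr <;> exact Matrix.l2_opNorm_mul _ _
    _ ≤ ‖H‖ * (1 - η * sigmaMin X ^ 2) + η * (c * ‖H‖) := by gcongr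
    _ = (1 + η * c - η * sigmaMin X ^ 2) * ‖H‖ := by ring

end L2Norm

theorem botBlock_diagonal_mul {d r : ℕ} (w : Fin d → ℝ) (M : Matrix (Fin d) (Fin r) ℝ) :
    botBlock (diagonal w * M) =
      diagonal (fun i : Fin (d - r) => w ⟨r + (i : ℕ), by have := i.isLt; omega⟩) *
        botBlock M := by
  ext i j
  simp [botBlock, diagonal_mul]

theorem botBlock_mul {d r : ℕ} (M : Matrix (Fin d) (Fin r) ℝ) (N : Matrix (Fin r) (Fin r) ℝ) :
    botBlock (M * N) = botBlock M * N :=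
  rfl

theorem transpose_mul_self_diagonal_sqrt_mul {d r : ℕ} {w : Fin d → ℝ} (hw : ∀ i, 0 ≤ w i)
    (M : Matrix (Fin d) (Fin r) ℝ) :
    (diagonal (fun i => √(w i)) * M)ᵀ * (diagonal (fun i => √(w i)) * M) =
      Mᵀ * (diagonal w * M) := by
  rw [transpose_mul, diagonal_transpose, Matrix.mul_assoc, ← Matrix.mul_assoc (diagonal _),
    diagonal_mul_diagonal]
  simp only [Real.mul_self_sqrt (hw _)]

/-- Recursion and one-step decay for the bottom block `H` of the retraction-free
eigenspace iteration. -/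
theorem retraction_free_bottom_block (d r : ℕ) (hr : 0 < r) (hrd : r < d)
    (lam : Fin d → ℝ)
    (hmono : ∀ i j : Fin d, i ≤ j → lam j ≤ lam i)
    (hnn : ∀ i, 0 ≤ lam i)
    (η : ℝ) (hη : 0 < η)
    (L L' : Matrix (Fin d) (Fin r) ℝ)
    (hstep : L' = L + η • ((1 - L * Lᵀ) * (Matrix.diagonal lam * L))) :
    (botBlock L' = botBlock L +
        η • (Matrix.diagonal (fun i : Fin (d - r) =>
            lam ⟨r + (i : ℕ), by have := i.isLt; omega⟩) * botBlock L) -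
        η • (botBlock L *
          ((Matrix.diagonal (fun i => Real.sqrt (lam i)) * L)ᵀ *
            (Matrix.diagonal (fun i => Real.sqrt (lam i)) * L)))) ∧
    (η * sigmaMax (Matrix.diagonal (fun i => Real.sqrt (lam i)) * L) ^ 2 ≤ 1 →
      sigmaMax (botBlock L') ≤
        (1 + η * lam ⟨r, hrd⟩ -
            η * sigmaMin (Matrix.diagonal (fun i => Real.sqrt (lam i)) * L) ^ 2) *
          sigmaMax (botBlock L)) := by
  have hrec : botBlock L' = botBlock L +
      η • (Matrix.diagonal (fun i : Fin (d - r) =>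
          lam ⟨r + (i : ℕ), by have := i.isLt; omega⟩) * botBlock L) -
      η • (botBlock L * ((Matrix.diagonal (fun i => Real.sqrt (lam i)) * L)ᵀ *
        (Matrix.diagonal (fun i => Real.sqrt (lam i)) * L))) := by
    rw [transpose_mul_self_diagonal_sqrt_mul hnn, ← botBlock_diagonal_mul, ← botBlock_mul,
      hstep, Matrix.sub_mul, Matrix.one_mul, Matrix.mul_assoc, smul_sub, ← add_sub_assoc]
    rfl
  refine ⟨hrec, fun hstepsize => ?_⟩
  rw [hrec]
  refine sigmaMax_add_smul_sub_smul_le hr _ _ _ hη.le hstepsize (hnn _) fun i => ?_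
  rw [abs_of_nonneg (hnn _)]
  exact hmono _ _ (Fin.mk_le_mk.mpr (Nat.le_add_right r i))
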